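/- Let Q = 2n + 2 and let μ be the Q-dimensional Hausdorff measure of the metric space (H(n), d_CC). Then: (i) μ is left-invariant, i.e. μ(p·E) = μ(E) for every p ∈ H(n) and every Borel set E; (ii) μ(δ_ε E) = ε^Q · μ(E) for every ε > 0 and every Borel set E; (iii) there exists a constant κ ∈ (0, ∞) such that μ = κ · λ, where λ is the Lebesgue measure on ℝ^{2n+1}. In particular the Hausdorff dimension of (H(n), d_CC) is Q = 2n + 2. -/

import Mathlib

open MeasureTheory Set Function
open scoped BigOperators Topology NNReal ENNReal

noncomputable section

/-- `ℝ^{2n}` with the Euclidean norm. -/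
abbrev E (n : ℕ) := EuclideanSpace ℝ (Fin n ⊕ Fin n)

/-- The standard symplectic form `ω(x,y) = ⟨Jx, y⟩` on `ℝ^{2n}`. -/
def symp {n : ℕ} (x y : E n) : ℝ :=
  ∑ i : Fin n, (x (Sum.inl i) * y (Sum.inr i) - x (Sum.inr i) * y (Sum.inl i))

/-- The Heisenberg group `H(n) = ℝ^{2n} × ℝ` as a set. -/
abbrev Heis (n : ℕ) := E n × ℝ

/-- The Heisenberg group operation. -/
def hmul {n : ℕ} (p q : Heis n) : Heis n :=
  (p.1 + q.1, p.2 + q.2 + (1/2) * symp p.1 q.1)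

/-- The dilation `δ_ε(x, x̄) = (εx, ε²x̄)`. -/
def dil {n : ℕ} (ε : ℝ) (p : Heis n) : Heis n := (ε • p.1, ε^2 * p.2)

/-- The a.e. horizontality condition on `[0,1]` for a curve `(c, cb)` in `H(n)`. -/
def HorizOn {n : ℕ} (c : ℝ → E n) (cb : ℝ → ℝ) : Prop :=
  ∀ᵐ t ∂(volume.restrict (Icc (0:ℝ) 1)),
    HasDerivAt cb ((1/2) * symp (c t) (deriv c t)) t

/-- The Carnot–Carathéodory distance on `H(n)`. -/
def ccDist {n : ℕ} (p q : Heis n) : ℝ :=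
  sInf { L : ℝ | ∃ (c : ℝ → E n) (cb : ℝ → ℝ) (K K' : ℝ≥0),
    LipschitzWith K c ∧ LipschitzWith K' cb ∧
    c 0 = p.1 ∧ cb 0 = p.2 ∧ c 1 = q.1 ∧ cb 1 = q.2 ∧
    HorizOn c cb ∧
    L = ∫ t in Icc (0:ℝ) 1, ‖deriv c t‖ }

/-- The diameter of a set for the Carnot–Carathéodory distance. -/
def ccDiam {n : ℕ} (S : Set (Heis n)) : ℝ≥0∞ :=
  ⨆ (a : Heis n) (_ : a ∈ S) (b : Heis n) (_ : b ∈ S), ENNReal.ofReal (ccDist a b)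

/-- The `d`-dimensional Hausdorff (outer) measure of a subset of `(H(n), d_CC)`:
`lim_{δ→0⁺} inf { Σᵢ (diam Uᵢ)^d }` over countable covers by sets of diameter at
most `δ`. -/
def hausMeas {n : ℕ} (d : ℝ) (S : Set (Heis n)) : ℝ≥0∞ :=
  ⨆ (δ : ℝ) (_ : 0 < δ),
    ⨅ (U : ℕ → Set (Heis n))
      (_ : (∀ i : ℕ, ccDiam (U i) ≤ ENNReal.ofReal δ) ∧ S ⊆ ⋃ i : ℕ, U i),
      ∑' i : ℕ, ccDiam (U i) ^ d

section Symplectic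

variable {n : ℕ}

lemma symp_add_left (x y z : E n) : symp (x + y) z = symp x z + symp y z := by
  simp only [symp, ← Finset.sum_add_distrib, PiLp.add_apply]
  exact Finset.sum_congr rfl fun i _ => by ring

lemma symp_add_right (x y z : E n) : symp x (y + z) = symp x y + symp x z := by
  simp only [symp, ← Finset.sum_add_distrib, PiLp.add_apply]
  exact Finset.sum_congr rfl fun i _ => by ring

lemma symp_smul_left (a : ℝ) (x y : E n) : symp (a • x) y = a * symp x y := by
  simp only [symp, Finset.mul_sum, PiLp.smul_apply, smul_eq_mul]
  exact Finset.sum_congr rfl fun i _ => by ring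

lemma symp_smul_right (a : ℝ) (x y : E n) : symp x (a • y) = a * symp x y := by
  simp only [symp, Finset.mul_sum, PiLp.smul_apply, smul_eq_mul]
  exact Finset.sum_congr rfl fun i _ => by ring

lemma symp_swap (x y : E n) : symp x y = -symp y x := by
  simp only [symp, ← Finset.sum_neg_distrib]
  exact Finset.sum_congr rfl fun i _ => by ring

@[simp] lemma symp_self (x : E n) : symp x x = 0 := by
  linarith [symp_swap x x]

@[simp] lemma symp_zero_left (x : E n) : symp 0 x = 0 := by simp [symp]

@[simp] lemma symp_zero_right (x : E n) : symp x 0 = 0 := by simp [symp]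

lemma symp_neg_left (x y : E n) : symp (-x) y = -symp x y := by
  simpa using symp_smul_left (-1) x y

lemma symp_neg_right (x y : E n) : symp x (-y) = -symp x y := by
  simpa using symp_smul_right (-1) x y

/-- The symplectic form is bounded by the product of the Euclidean norms. -/
lemma abs_symp_le (x y : E n) : |symp x y| ≤ ‖x‖ * ‖y‖ := by
  let Jx : E n := WithLp.toLp 2 (Sum.elim (fun i => -x (Sum.inr i)) fun i => x (Sum.inl i))
  have h : symp x y = inner ℝ Jx y := by
    simp only [symp, PiLp.inner_apply, Fintype.sum_sum_type, Jx, Sum.elim_inl, Sum.elim_inr,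
      ← Finset.sum_add_distrib]
    refine Finset.sum_congr rfl fun i _ => ?_
    simp only [RCLike.inner_apply, conj_trivial]
    ring
  have hJ : ‖Jx‖ = ‖x‖ := by
    simp [EuclideanSpace.norm_eq, Fintype.sum_sum_type, Jx, add_comm]
  rw [h, ← hJ]
  exact abs_real_inner_le_norm Jx y

/-- The symplectic form as a continuous linear map in its second variable. -/
def sympCLM (a : E n) : E n →L[ℝ] ℝ :=
  LinearMap.mkContinuous
    { toFun := symp a
      map_add' := symp_add_right a
      map_smul' := fun r x => symp_smul_right r a x } ‖a‖ fun x => abs_symp_le a x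

@[simp] lemma sympCLM_apply (a x : E n) : sympCLM a x = symp a x := rfl

lemma continuous_symp : Continuous fun p : E n × E n => symp p.1 p.2 := by
  unfold symp
  fun_prop

end Symplectic

section Curves

variable {n : ℕ}

/-- `(c, cb)` is a Lipschitz horizontal curve from `p` to `q`, parametrised on `[0,1]`. -/
structure IsHorizCurve (p q : Heis n) (c : ℝ → E n) (cb : ℝ → ℝ) : Prop where
  lipschitz_fst : ∃ K : ℝ≥0, LipschitzWith K c
  lipschitz_snd : ∃ K : ℝ≥0, LipschitzWith K cb
  fst_zero : c 0 = p.1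
  snd_zero : cb 0 = p.2
  fst_one : c 1 = q.1
  snd_one : cb 1 = q.2
  horiz : HorizOn c cb

/-- The length of a curve in `ℝ^{2n}` parametrised on `[0,1]`. -/
def curveLength (c : ℝ → E n) : ℝ := ∫ t in Icc (0 : ℝ) 1, ‖deriv c t‖

lemma curveLength_nonneg (c : ℝ → E n) : 0 ≤ curveLength c :=
  integral_nonneg fun _ => norm_nonneg _

lemma curveLength_eq_intervalIntegral (c : ℝ → E n) :
    curveLength c = ∫ t in (0 : ℝ)..1, ‖deriv c t‖ := by
  rw [curveLength, intervalIntegral.integral_of_le zero_le_one, integral_Icc_eq_integral_Ioc]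

lemma horizOn_iff {c : ℝ → E n} {cb : ℝ → ℝ} :
    HorizOn c cb ↔
      ∀ᵐ t : ℝ, t ∈ Icc (0 : ℝ) 1 → HasDerivAt cb ((1/2) * symp (c t) (deriv c t)) t := by
  rw [HorizOn, ae_restrict_iff' measurableSet_Icc]

lemma ccDist_eq (p q : Heis n) :
    ccDist p q = sInf {L | ∃ c cb, IsHorizCurve p q c cb ∧ L = curveLength c} := by
  unfold ccDist
  congr 1
  ext L
  constructor
  · rintro ⟨c, cb, K, K', h1, h2, h3, h4, h5, h6, h7, h8⟩
    exact ⟨c, cb, ⟨⟨K, h1⟩, ⟨K', h2⟩, h3, h4, h5, h6, h7⟩, h8⟩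
  · rintro ⟨c, cb, ⟨⟨K, h1⟩, ⟨K', h2⟩, h3, h4, h5, h6, h7⟩, h8⟩
    exact ⟨c, cb, K, K', h1, h2, h3, h4, h5, h6, h7, h8⟩

lemma IsHorizCurve.ccDist_le {p q : Heis n} {c : ℝ → E n} {cb : ℝ → ℝ}
    (h : IsHorizCurve p q c cb) : ccDist p q ≤ curveLength c := by
  rw [ccDist_eq]
  refine csInf_le ⟨0, ?_⟩ ⟨c, cb, h, rfl⟩
  rintro _ ⟨c, cb, -, rfl⟩
  exact curveLength_nonneg c

lemma ccDist_nonneg (p q : Heis n) : 0 ≤ ccDist p q := by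
  rw [ccDist_eq]
  refine Real.sInf_nonneg ?_
  rintro _ ⟨c, cb, -, rfl⟩
  exact curveLength_nonneg c

/-- Left translation of a horizontal curve. -/
lemma IsHorizCurve.hmul {p q : Heis n} {c : ℝ → E n} {cb : ℝ → ℝ}
    (h : IsHorizCurve p q c cb) (a : Heis n) :
    IsHorizCurve (hmul a p) (hmul a q) (fun t => a.1 + c t)
      (fun t => a.2 + cb t + (1/2) * symp a.1 (c t)) := by
  obtain ⟨K, hK⟩ := h.lipschitz_fst
  obtain ⟨K', hK'⟩ := h.lipschitz_snd
  refine ⟨⟨_, (LipschitzWith.const a.1).add hK⟩,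
    ⟨_, ((LipschitzWith.const a.2).add hK').add
      (((1/2 : ℝ) • sympCLM a.1).lipschitz.comp hK)⟩, ?_, ?_, ?_, ?_, ?_⟩
  · simp [_root_.hmul, h.fst_zero]
  · simp [_root_.hmul, h.fst_zero, h.snd_zero]
  · simp [_root_.hmul, h.fst_one]
  · simp [_root_.hmul, h.fst_one, h.snd_one]
  · rw [horizOn_iff]
    filter_upwards [horizOn_iff.1 h.horiz, hK.ae_differentiableAt] with t ht hd hmem
    have h1 := ((ht hmem).const_add a.2).add
      (((1/2 : ℝ) • sympCLM a.1).hasFDerivAt.comp_hasDerivAt t hd.hasDerivAt)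
    have h2 : deriv (fun t => a.1 + c t) t = deriv c t := deriv_const_add _
    rw [h2]
    refine h1.congr_deriv ?_
    simp [symp_add_left]
    ring

lemma curveLength_const_add (a : E n) (c : ℝ → E n) :
    curveLength (fun t => a + c t) = curveLength c := by
  simp [curveLength]

/-- Dilation of a horizontal curve. -/
lemma IsHorizCurve.dil {p q : Heis n} {c : ℝ → E n} {cb : ℝ → ℝ}
    (h : IsHorizCurve p q c cb) (ε : ℝ) :
    IsHorizCurve (dil ε p) (dil ε q) (fun t => ε • c t) (fun t => ε ^ 2 * cb t) := by
  obtain ⟨K, hK⟩ := h.lipschitz_fst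
  obtain ⟨K', hK'⟩ := h.lipschitz_snd
  refine ⟨⟨_, (lipschitzWith_smul ε).comp hK⟩, ⟨_, (lipschitzWith_smul (ε ^ 2)).comp hK'⟩,
    ?_, ?_, ?_, ?_, ?_⟩
  · simp [_root_.dil, h.fst_zero]
  · simp [_root_.dil, h.snd_zero]
  · simp [_root_.dil, h.fst_one]
  · simp [_root_.dil, h.snd_one]
  · rw [horizOn_iff]
    filter_upwards [horizOn_iff.1 h.horiz] with t ht hmem
    refine ((ht hmem).const_mul (ε ^ 2)).congr_deriv ?_
    have : deriv (fun t => ε • c t) t = ε • deriv c t := deriv_fun_const_smul_field _ _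
    rw [this, symp_smul_left, symp_smul_right]
    ring

lemma curveLength_const_smul {ε : ℝ} (hε : 0 ≤ ε) (c : ℝ → E n) :
    curveLength (fun t => ε • c t) = ε * curveLength c := by
  have : ∀ t, deriv (fun t => ε • c t) t = ε • deriv c t :=
    fun t => deriv_fun_const_smul_field _ _
  simp [curveLength, this, norm_smul, abs_of_nonneg hε, integral_const_mul]

lemma ae_comp_affine {P : ℝ → Prop} (h : ∀ᵐ s : ℝ, P s) {a : ℝ} (ha : a ≠ 0) (b : ℝ) :
    ∀ᵐ t : ℝ, P (a * t + b) := by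
  have h1 : Measure.QuasiMeasurePreserving (fun t : ℝ => a * t) := by
    refine ⟨by fun_prop, ?_⟩
    rw [Real.map_volume_mul_left ha]
    exact Measure.smul_absolutelyContinuous
  have h2 := (measurePreserving_add_right (volume : Measure ℝ) b).quasiMeasurePreserving
  exact h1.ae (h2.ae h)

/-- Time reversal of a horizontal curve. -/
lemma IsHorizCurve.reverse {p q : Heis n} {c : ℝ → E n} {cb : ℝ → ℝ}
    (h : IsHorizCurve p q c cb) :
    IsHorizCurve q p (fun t => c (1 - t)) (fun t => cb (1 - t)) := by
  obtain ⟨K, hK⟩ := h.lipschitz_fst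
  obtain ⟨K', hK'⟩ := h.lipschitz_snd
  have hl : LipschitzWith (0 + 1) fun t : ℝ => 1 - t :=
    (LipschitzWith.const 1).sub LipschitzWith.id
  refine ⟨⟨_, hK.comp hl⟩, ⟨_, hK'.comp hl⟩, ?_, ?_, ?_, ?_, ?_⟩
  · simp [h.fst_one]
  · simp [h.snd_one]
  · simp [h.fst_zero]
  · simp [h.snd_zero]
  · rw [horizOn_iff]
    filter_upwards [ae_comp_affine (horizOn_iff.1 h.horiz) (neg_ne_zero.2 one_ne_zero) 1]
      with t ht hmem
    rw [show -1 * t + 1 = 1 - t by ring] at ht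
    have h1 := (ht ⟨by linarith [hmem.2], by linarith [hmem.1]⟩).comp_const_sub 1 t
    refine h1.congr_deriv ?_
    rw [deriv_comp_const_sub, symp_neg_right]
    ring

lemma curveLength_reverse (c : ℝ → E n) :
    curveLength (fun t => c (1 - t)) = curveLength c := by
  simp only [curveLength_eq_intervalIntegral, deriv_comp_const_sub, norm_neg]
  rw [intervalIntegral.integral_comp_sub_left (fun t => ‖deriv c t‖)]
  simp

/-- The nearest-point retraction of the line onto `[0,1]`. -/
def clampUnit (t : ℝ) : ℝ := max 0 (min 1 t)

lemma lipschitzWith_clampUnit : LipschitzWith 1 clampUnit :=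
  (LipschitzWith.id.const_min 1).const_max 0

lemma clampUnit_mem (t : ℝ) : clampUnit t ∈ Icc (0 : ℝ) 1 :=
  ⟨le_max_left _ _, max_le zero_le_one (min_le_left _ _)⟩

lemma clampUnit_of_mem {t : ℝ} (h : t ∈ Icc (0 : ℝ) 1) : clampUnit t = t := by
  rw [clampUnit, min_eq_right h.2, max_eq_right h.1]

lemma clampUnit_of_nonpos {t : ℝ} (h : t ≤ 0) : clampUnit t = 0 := by
  rw [clampUnit, min_eq_right (h.trans zero_le_one), max_eq_left h]

lemma clampUnit_of_one_le {t : ℝ} (h : 1 ≤ t) : clampUnit t = 1 := by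
  rw [clampUnit, min_eq_left h, max_eq_right zero_le_one]

/-- Concatenation of two curves parametrised on `[0,1]`. -/
def concat {F : Type*} [AddCommGroup F] (f g : ℝ → F) (t : ℝ) : F :=
  f (clampUnit (2 * t)) + (g (clampUnit (2 * t - 1)) - g 0)

lemma concat_of_mem_left {F : Type*} [AddCommGroup F] (f g : ℝ → F) {t : ℝ}
    (ht : t ∈ Icc (0 : ℝ) (1 / 2)) : concat f g t = f (2 * t) := by
  rw [concat, clampUnit_of_mem ⟨by linarith [ht.1], by linarith [ht.2]⟩,
    clampUnit_of_nonpos (by linarith [ht.2]), sub_self, add_zero]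

lemma concat_of_mem_right {F : Type*} [AddCommGroup F] {f g : ℝ → F} (hfg : f 1 = g 0) {t : ℝ}
    (ht : t ∈ Icc (1 / 2 : ℝ) 1) : concat f g t = g (2 * t - 1) := by
  rw [concat, clampUnit_of_one_le (by linarith [ht.1]),
    clampUnit_of_mem ⟨by linarith [ht.1], by linarith [ht.2]⟩, hfg, add_sub_cancel]

lemma lipschitzWith_concat {F : Type*} [SeminormedAddCommGroup F] {f g : ℝ → F} {K K' : ℝ≥0}
    (hf : LipschitzWith K f) (hg : LipschitzWith K' g) :
    ∃ C : ℝ≥0, LipschitzWith C (concat f g) := by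
  have h2 : LipschitzWith _ fun t : ℝ => 2 * t := lipschitzWith_smul (2 : ℝ)
  exact ⟨_, (hf.comp (lipschitzWith_clampUnit.comp h2)).add
    ((hg.comp (lipschitzWith_clampUnit.comp (h2.sub (LipschitzWith.const 1)))).sub
      (LipschitzWith.const (g 0)))⟩

lemma concat_eventuallyEq_left {F : Type*} [AddCommGroup F] (f g : ℝ → F) {t : ℝ}
    (ht : t ∈ Ioo (0 : ℝ) (1 / 2)) : concat f g =ᶠ[𝓝 t] fun s => f (2 * s) := by
  filter_upwards [Ioo_mem_nhds ht.1 ht.2] with s hs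
  exact concat_of_mem_left f g ⟨hs.1.le, hs.2.le⟩

lemma concat_eventuallyEq_right {F : Type*} [AddCommGroup F] {f g : ℝ → F} (hfg : f 1 = g 0)
    {t : ℝ} (ht : t ∈ Ioo (1 / 2 : ℝ) 1) : concat f g =ᶠ[𝓝 t] fun s => g (2 * s - 1) := by
  filter_upwards [Ioo_mem_nhds ht.1 ht.2] with s hs
  exact concat_of_mem_right hfg ⟨hs.1.le, hs.2.le⟩

lemma deriv_concat_left (f g : ℝ → E n) {t : ℝ} (ht : t ∈ Ioo (0 : ℝ) (1 / 2)) :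
    deriv (concat f g) t = (2 : ℝ) • deriv f (2 * t) := by
  rw [(concat_eventuallyEq_left f g ht).deriv_eq]
  exact deriv_comp_mul_left 2 f t

lemma deriv_concat_right {f g : ℝ → E n} (hfg : f 1 = g 0) {t : ℝ}
    (ht : t ∈ Ioo (1 / 2 : ℝ) 1) : deriv (concat f g) t = (2 : ℝ) • deriv g (2 * t - 1) := by
  rw [(concat_eventuallyEq_right hfg ht).deriv_eq]
  have := deriv_comp_mul_left 2 (fun s => g (s - 1)) t
  rw [deriv_comp_sub_const] at this
  exact this

/-- Concatenation of horizontal curves. -/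
lemma IsHorizCurve.concat {p q r : Heis n} {c d : ℝ → E n} {cb db : ℝ → ℝ}
    (h : IsHorizCurve p q c cb) (h' : IsHorizCurve q r d db) :
    IsHorizCurve p r (concat c d) (concat cb db) := by
  obtain ⟨K, hK⟩ := h.lipschitz_fst
  obtain ⟨K', hK'⟩ := h.lipschitz_snd
  obtain ⟨C, hC⟩ := h'.lipschitz_fst
  obtain ⟨C', hC'⟩ := h'.lipschitz_snd
  have e : c 1 = d 0 := h.fst_one.trans h'.fst_zero.symm
  have e' : cb 1 = db 0 := h.snd_one.trans h'.snd_zero.symm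
  have m0 : (0 : ℝ) ∈ Icc (0 : ℝ) (1 / 2) := by norm_num
  have m1 : (1 : ℝ) ∈ Icc (1 / 2 : ℝ) 1 := by norm_num
  refine ⟨lipschitzWith_concat hK hC, lipschitzWith_concat hK' hC', ?_, ?_, ?_, ?_, ?_⟩
  · simp [concat_of_mem_left c d m0, h.fst_zero]
  · simp [concat_of_mem_left cb db m0, h.snd_zero]
  · rw [concat_of_mem_right e m1, ← h'.fst_one]; norm_num
  · rw [concat_of_mem_right e' m1, ← h'.snd_one]; norm_num
  · rw [horizOn_iff]
    filter_upwards [ae_comp_affine (horizOn_iff.1 h.horiz) two_ne_zero 0,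
      ae_comp_affine (horizOn_iff.1 h'.horiz) two_ne_zero (-1),
      Measure.ae_ne volume (0 : ℝ), Measure.ae_ne volume (1 / 2 : ℝ),
      Measure.ae_ne volume (1 : ℝ)] with t ht ht' n0 nh n1 hmem
    rcases lt_or_gt_of_ne nh with hlt | hlt
    · have hm : t ∈ Ioo (0 : ℝ) (1 / 2) := ⟨lt_of_le_of_ne hmem.1 n0.symm, hlt⟩
      rw [add_zero] at ht
      have h1 := (ht ⟨by linarith [hm.1], by linarith [hm.2]⟩).comp t
        ((hasDerivAt_id t).const_mul 2)
      refine (h1.congr_of_eventuallyEq (concat_eventuallyEq_left cb db hm)).congr_deriv ?_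
      rw [deriv_concat_left c d hm, (concat_eventuallyEq_left c d hm).eq_of_nhds,
        symp_smul_right]
      ring
    · have hm : t ∈ Ioo (1 / 2 : ℝ) 1 := ⟨hlt, lt_of_le_of_ne hmem.2 n1⟩
      rw [← sub_eq_add_neg] at ht'
      have h1 := (ht' ⟨by linarith [hm.1], by linarith [hm.2]⟩).comp t
        (((hasDerivAt_id t).const_mul 2).sub_const 1)
      refine (h1.congr_of_eventuallyEq (concat_eventuallyEq_right e' hm)).congr_deriv ?_
      rw [deriv_concat_right e hm, (concat_eventuallyEq_right e hm).eq_of_nhds,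
        symp_smul_right]
      ring

lemma LipschitzWith.intervalIntegrable_norm_deriv {K : ℝ≥0} {c : ℝ → E n}
    (h : LipschitzWith K c) (a b : ℝ) : IntervalIntegrable (fun t => ‖deriv c t‖) volume a b := by
  refine (intervalIntegrable_const (c := (K : ℝ))).mono_fun
    (measurable_deriv c).norm.aestronglyMeasurable (Filter.Eventually.of_forall fun t => ?_)
  simpa using norm_deriv_le_of_lipschitz h

lemma curveLength_concat {c d : ℝ → E n} {K K' : ℝ≥0} (hc : LipschitzWith K c)
    (hd : LipschitzWith K' d) (e : c 1 = d 0) :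
    curveLength (concat c d) = curveLength c + curveLength d := by
  obtain ⟨C, hC⟩ := lipschitzWith_concat hc hd
  simp only [curveLength_eq_intervalIntegral]
  rw [← intervalIntegral.integral_add_adjacent_intervals
    (hC.intervalIntegrable_norm_deriv 0 (1 / 2)) (hC.intervalIntegrable_norm_deriv (1 / 2) 1)]
  congr 1
  · have : ∫ t in (0 : ℝ)..(1 / 2), ‖deriv (concat c d) t‖ =
        ∫ t in (0 : ℝ)..(1 / 2), 2 * ‖deriv c (2 * t)‖ := by
      refine intervalIntegral.integral_congr_Ioo_of_le (by norm_num) fun t ht => ?_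
      rw [deriv_concat_left c d ht, norm_smul]
      simp
    rw [this, intervalIntegral.integral_const_mul,
      intervalIntegral.integral_comp_mul_left (fun t => ‖deriv c t‖) two_ne_zero]
    simp
  · have : ∫ t in (1 / 2 : ℝ)..1, ‖deriv (concat c d) t‖ =
        ∫ t in (1 / 2 : ℝ)..1, 2 * ‖deriv d (2 * t - 1)‖ := by
      refine intervalIntegral.integral_congr_Ioo_of_le (by norm_num) fun t ht => ?_
      rw [deriv_concat_right e ht, norm_smul]
      simp
    rw [this, intervalIntegral.integral_const_mul,
      intervalIntegral.integral_comp_mul_sub (fun t => ‖deriv d t‖) two_ne_zero]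
    norm_num
    ring

end Curves

section LowerBound

variable {n : ℕ}

/-- A horizontal curve issuing from the origin stays within its length from the origin. -/
lemma norm_le_curveLength {c : ℝ → E n} {K : ℝ≥0} (hc : LipschitzWith K c) (h0 : c 0 = 0)
    {s : ℝ} (hs : s ∈ Icc (0 : ℝ) 1) : ‖c s‖ ≤ curveLength c := by
  set y := c s with hy
  have hlip : LipschitzWith _ fun t => inner ℝ y (c t) := (innerSL ℝ y).lipschitz.comp hc
  have hftc := (hlip.lipschitzOnWith (s := uIcc 0 s)).absolutelyContinuousOnInterval
    |>.integral_deriv_eq_sub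
  have hle : ∫ t in (0 : ℝ)..s, deriv (fun t => inner ℝ y (c t)) t ≤
      ∫ t in (0 : ℝ)..s, ‖y‖ * ‖deriv c t‖ := by
    refine intervalIntegral.integral_mono_ae hs.1
      (hlip.lipschitzOnWith (s := uIcc 0 s)).absolutelyContinuousOnInterval.intervalIntegrable_deriv
      ((hc.intervalIntegrable_norm_deriv 0 s).const_mul _) ?_
    filter_upwards [hc.ae_differentiableAt] with t ht
    have h1 : HasDerivAt (fun t => inner ℝ y (c t)) (inner ℝ y (deriv c t)) t :=
      (innerSL ℝ y).hasFDerivAt.comp_hasDerivAt t ht.hasDerivAt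
    rw [h1.deriv]
    exact real_inner_le_norm _ _
  have hmono : ∫ t in (0 : ℝ)..s, ‖deriv c t‖ ≤ curveLength c := by
    rw [curveLength_eq_intervalIntegral]
    exact intervalIntegral.integral_mono_interval le_rfl hs.1 hs.2
      (Filter.Eventually.of_forall fun t => norm_nonneg _) (hc.intervalIntegrable_norm_deriv 0 1)
  rw [hftc, h0, inner_zero_right, sub_zero, real_inner_self_eq_norm_sq,
    intervalIntegral.integral_const_mul] at hle
  rcases (norm_nonneg y).eq_or_lt with h | h
  · rw [← h]; exact curveLength_nonneg c
  · nlinarith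

lemma IsHorizCurve.abs_snd_le {q : Heis n} {c : ℝ → E n} {cb : ℝ → ℝ}
    (h : IsHorizCurve 0 q c cb) : |q.2| ≤ curveLength c ^ 2 := by
  obtain ⟨K, hK⟩ := h.lipschitz_fst
  obtain ⟨K', hK'⟩ := h.lipschitz_snd
  have hftc := (hK'.lipschitzOnWith (s := uIcc 0 1)).absolutelyContinuousOnInterval
    |>.integral_deriv_eq_sub
  rw [h.snd_zero, h.snd_one, Prod.snd_zero, sub_zero] at hftc
  rw [← hftc]
  have hle : ‖∫ t in (0 : ℝ)..1, deriv cb t‖ ≤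
      ∫ t in (0 : ℝ)..1, curveLength c * ‖deriv c t‖ := by
    refine intervalIntegral.norm_integral_le_of_norm_le zero_le_one ?_
      ((hK.intervalIntegrable_norm_deriv 0 1).const_mul _)
    filter_upwards [horizOn_iff.1 h.horiz] with t ht hmem
    have hmem' := Ioc_subset_Icc_self hmem
    rw [(ht hmem').deriv, Real.norm_eq_abs, abs_mul]
    have h1 := abs_symp_le (c t) (deriv c t)
    have h2 := norm_le_curveLength hK h.fst_zero hmem'
    have h3 : ‖c t‖ * ‖deriv c t‖ ≤ curveLength c * ‖deriv c t‖ := by gcongr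
    rw [abs_of_pos (by norm_num : (0 : ℝ) < 1 / 2)]
    linarith [abs_nonneg (symp (c t) (deriv c t))]
  rw [intervalIntegral.integral_const_mul, ← curveLength_eq_intervalIntegral] at hle
  rw [Real.norm_eq_abs] at hle
  linarith [sq (curveLength c)]

end LowerBound

section UpperBound

variable {n : ℕ}

/-- A smooth horizontal curve whose speed is at most `M` on `[0,1]` has length at most `M`. -/
lemma exists_isHorizCurve_of_hasDerivAt {c c' : ℝ → E n} {cb : ℝ → ℝ} {M : ℝ}
    (hc : ∀ t, HasDerivAt c (c' t) t) (hcb : ∀ t, HasDerivAt cb ((1/2) * symp (c t) (c' t)) t)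
    (hM : ∀ t ∈ Icc (0 : ℝ) 1, ‖c' t‖ ≤ M) :
    ∃ d db, IsHorizCurve (c 0, cb 0) (c 1, cb 1) d db ∧ curveLength d ≤ M := by
  have hM0 : 0 ≤ M := (norm_nonneg _).trans (hM 0 (by simp))
  have hcont : Continuous c := continuous_iff_continuousAt.2 fun t => (hc t).continuousAt
  obtain ⟨R, hR⟩ := isCompact_Icc.exists_bound_of_continuousOn (s := Icc (0 : ℝ) 1)
    hcont.continuousOn
  have hR0 : 0 ≤ R := (norm_nonneg _).trans (hR 0 (by simp))
  have l1 : LipschitzOnWith M.toNNReal c (Icc 0 1) := by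
    refine (convex_Icc 0 1).lipschitzOnWith_of_nnnorm_hasDerivWithin_le
      (fun t _ => (hc t).hasDerivWithinAt) fun t ht => ?_
    rw [← NNReal.coe_le_coe, Real.coe_toNNReal M hM0]
    exact hM t ht
  have l2 : LipschitzOnWith (R * M).toNNReal cb (Icc 0 1) := by
    refine (convex_Icc 0 1).lipschitzOnWith_of_nnnorm_hasDerivWithin_le
      (fun t _ => (hcb t).hasDerivWithinAt) fun t ht => ?_
    rw [← NNReal.coe_le_coe, Real.coe_toNNReal _ (mul_nonneg hR0 hM0), coe_nnnorm,
      Real.norm_eq_abs, abs_mul, abs_of_pos (by norm_num : (0 : ℝ) < 1 / 2)]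
    have h1 := abs_symp_le (c t) (c' t)
    have h2 : ‖c t‖ * ‖c' t‖ ≤ R * M :=
      mul_le_mul (hR t ht) (hM t ht) (norm_nonneg _) hR0
    linarith [abs_nonneg (symp (c t) (c' t))]
  have hcl : LipschitzOnWith 1 clampUnit univ := lipschitzWith_clampUnit.lipschitzOnWith
  have e0 : clampUnit 0 = 0 := clampUnit_of_nonpos le_rfl
  have e1 : clampUnit 1 = 1 := clampUnit_of_one_le le_rfl
  have hev : ∀ t ∈ Ioo (0 : ℝ) 1, clampUnit =ᶠ[𝓝 t] id := fun t ht => by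
    filter_upwards [Ioo_mem_nhds ht.1 ht.2] with s hs
    exact clampUnit_of_mem ⟨hs.1.le, hs.2.le⟩
  have hd : ∀ t ∈ Ioo (0 : ℝ) 1, HasDerivAt (fun t => c (clampUnit t)) (c' t) t := fun t ht =>
    (hc t).congr_of_eventuallyEq ((hev t ht).fun_comp c)
  have hlip : LipschitzWith (M.toNNReal * 1) fun t => c (clampUnit t) :=
    lipschitzOnWith_univ.1 (l1.comp hcl fun t _ => clampUnit_mem t)
  refine ⟨fun t => c (clampUnit t), fun t => cb (clampUnit t),
    ⟨⟨_, hlip⟩, ⟨_, lipschitzOnWith_univ.1 (l2.comp hcl fun t _ => clampUnit_mem t)⟩,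
      by simp [e0], by simp [e0], by simp [e1], by simp [e1], ?_⟩, ?_⟩
  · rw [horizOn_iff]
    filter_upwards [Measure.ae_ne volume (0 : ℝ), Measure.ae_ne volume (1 : ℝ)] with t n0 n1 hmem
    have ht : t ∈ Ioo (0 : ℝ) 1 := ⟨lt_of_le_of_ne hmem.1 n0.symm, lt_of_le_of_ne hmem.2 n1⟩
    rw [(hd t ht).deriv, clampUnit_of_mem hmem]
    exact (hcb t).congr_of_eventuallyEq ((hev t ht).fun_comp cb)
  · rw [curveLength]
    calc ∫ t in Icc (0 : ℝ) 1, ‖deriv (fun t => c (clampUnit t)) t‖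
        ≤ ∫ t in Icc (0 : ℝ) 1, M := by
          refine setIntegral_mono ?_ ?_ fun t => ?_
          · exact (intervalIntegrable_iff_integrableOn_Icc_of_le zero_le_one).1
              (hlip.intervalIntegrable_norm_deriv 0 1)
          · exact integrableOn_const (by simp)
          · simpa [hM0] using norm_deriv_le_of_lipschitz (x₀ := t) hlip
      _ = M := by simp

lemma hasDerivAt_septic (a₁ a₂ a₃ a₄ a₅ a₆ a₇ t : ℝ) :
    HasDerivAt (fun s : ℝ => a₁ * s + a₂ * s ^ 2 + a₃ * s ^ 3 + a₄ * s ^ 4 + a₅ * s ^ 5 +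
      a₆ * s ^ 6 + a₇ * s ^ 7)
      (a₁ + a₂ * (2 * t) + a₃ * (3 * t ^ 2) + a₄ * (4 * t ^ 3) + a₅ * (5 * t ^ 4) +
        a₆ * (6 * t ^ 5) + a₇ * (7 * t ^ 6)) t := by
  have h := fun (k : ℕ) (a : ℝ) => (hasDerivAt_pow k t).const_mul a
  have := ((((((h 1 a₁).add (h 2 a₂)).add (h 3 a₃)).add (h 4 a₄)).add (h 5 a₅)).add
    (h 6 a₆)).add (h 7 a₇)
  refine (this.congr_of_eventuallyEq (Filter.Eventually.of_forall fun s => ?_)).congr_deriv ?_ <;>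
    simp

/-- Every point is joined to the origin by a horizontal curve: a segment perturbed by a closed
loop of mean zero in the first symplectic plane, which corrects the vertical coordinate. -/
lemma exists_isHorizCurve_zero (hn : 1 ≤ n) (p : Heis n) :
    ∃ c cb, IsHorizCurve 0 p c cb ∧ curveLength c ≤ 1000 * (‖p.1‖ + √|p.2|) := by
  obtain ⟨x, z⟩ := p
  let e : E n := EuclideanSpace.single (Sum.inl ⟨0, hn⟩) 1
  let f : E n := EuclideanSpace.single (Sum.inr ⟨0, hn⟩) 1
  have hef : symp e f = 1 := by
    simp [symp, e, f]
  have hfe : symp f e = -1 := by rw [symp_swap, hef]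
  have he : ‖e‖ = 1 := by simp [e]
  have hf : ‖f‖ = 1 := by simp [f]
  set r := √|z| with hr
  have hr0 : 0 ≤ r := Real.sqrt_nonneg _
  obtain ⟨σ, hσ, hσz⟩ : ∃ σ : ℝ, |σ| = 70 ∧ r ^ 2 * σ = 70 * z := by
    rw [hr, Real.sq_sqrt (abs_nonneg z)]
    rcases le_total 0 z with h | h
    · exact ⟨70, by norm_num, by rw [abs_of_nonneg h]; ring⟩
    · exact ⟨-70, by norm_num, by rw [abs_of_nonpos h]; ring⟩
  let u : ℝ → ℝ := fun s => s - 6 * s ^ 2 + 10 * s ^ 3 - 5 * s ^ 4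
  let v : ℝ → ℝ := fun s => s - 3 * s ^ 2 + 2 * s ^ 3
  let u' : ℝ → ℝ := fun s => 1 - 12 * s + 30 * s ^ 2 - 20 * s ^ 3
  let v' : ℝ → ℝ := fun s => 1 - 6 * s + 6 * s ^ 2
  have hu : ∀ t, HasDerivAt u (u' t) t := fun t => by
    convert! hasDerivAt_septic 1 (-6) 10 (-5) 0 0 0 t using 1
    · ext s; simp only [u]; ring
    · simp only [u']; ring
  have hv : ∀ t, HasDerivAt v (v' t) t := fun t => by
    convert! hasDerivAt_septic 1 (-3) 2 0 0 0 0 t using 1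
    · ext s; simp only [v]; ring
    · simp only [v']; ring
  let c : ℝ → E n := fun s => s • x + ((r * u s) • e + (r * σ * v s) • f)
  let c' : ℝ → E n := fun s => x + ((r * u' s) • e + (r * σ * v' s) • f)
  have hc : ∀ t, HasDerivAt c (c' t) t := fun t => by
    have := ((hasDerivAt_id t).smul_const x).add
      ((((hu t).const_mul r).smul_const e).add (((hv t).const_mul (r * σ)).smul_const f))
    rw [one_smul] at this
    exact this
  have hsymp : ∀ s, symp (c s) (c' s) = r * symp x e * (s * u' s - u s) +
      r * σ * symp x f * (s * v' s - v s) + r ^ 2 * σ * (u s * v' s - v s * u' s) := by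
    intro s
    simp only [c, c', symp_add_left, symp_add_right, symp_smul_left, symp_smul_right, symp_self,
      hef, hfe, symp_swap e x, symp_swap f x]
    ring
  set A := r * symp x e
  set B := r * σ * symp x f
  let cb : ℝ → ℝ := fun s => 0 * s + 0 * s ^ 2 + (-2 * A - B + r ^ 2 * σ) / 2 * s ^ 3 +
    (5 * A + B - 4 * (r ^ 2 * σ)) / 2 * s ^ 4 + (-3 * A + 33 / 5 * (r ^ 2 * σ)) / 2 * s ^ 5 +
    (-5 * (r ^ 2 * σ) / 2) * s ^ 6 + 5 / 7 * (r ^ 2 * σ) * s ^ 7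
  have hcb : ∀ t, HasDerivAt cb ((1/2) * symp (c t) (c' t)) t := fun t => by
    refine (hasDerivAt_septic _ _ _ _ _ _ _ t).congr_deriv ?_
    rw [hsymp]
    simp only [u, v, u', v']
    ring
  have hbound : ∀ t ∈ Icc (0 : ℝ) 1, ‖c' t‖ ≤ 1000 * (‖x‖ + r) := fun t ht => by
    have hu'' : |u' t| ≤ 63 := by
      have := pow_le_one₀ ht.1 ht.2 (n := 2)
      have := pow_le_one₀ ht.1 ht.2 (n := 3)
      have := pow_nonneg ht.1 2
      have := pow_nonneg ht.1 3
      rw [abs_le]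
      constructor <;> simp only [u'] <;> linarith [ht.1, ht.2]
    have hv'' : |v' t| ≤ 13 := by
      have := pow_le_one₀ ht.1 ht.2 (n := 2)
      have := pow_nonneg ht.1 2
      rw [abs_le]
      constructor <;> simp only [v'] <;> linarith [ht.1, ht.2]
    calc ‖c' t‖ ≤ ‖x‖ + (‖(r * u' t) • e‖ + ‖(r * σ * v' t) • f‖) :=
          (norm_add_le _ _).trans (by gcongr; exact norm_add_le _ _)
      _ = ‖x‖ + (r * |u' t| + r * 70 * |v' t|) := by
          simp [norm_smul, he, hf, hσ, abs_of_nonneg hr0]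
      _ ≤ ‖x‖ + (r * 63 + r * 70 * 13) := by gcongr
      _ ≤ 1000 * (‖x‖ + r) := by linarith [norm_nonneg x]
  obtain ⟨d, db, hd, hlen⟩ := exists_isHorizCurve_of_hasDerivAt hc hcb hbound
  refine ⟨d, db, ?_, hlen⟩
  have h0 : (c 0, cb 0) = (0 : Heis n) := by
    ext1 <;> simp [c, cb, u, v]
  have h1 : (c 1, cb 1) = (x, z) := by
    ext1
    · have hu1 : u 1 = 0 := by norm_num [u]
      have hv1 : v 1 = 0 := by norm_num [v]
      simp [c, hu1, hv1]
    · simp only [cb, hσz]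
      ring
  rwa [h0, h1] at hd

end UpperBound

section Metric

variable {n : ℕ}

/-- The inverse in the Heisenberg group is the negation. -/
lemma hmul_neg_hmul (a p : Heis n) : hmul (-a) (hmul a p) = p := by
  ext1
  · simp [hmul]
  · simp only [hmul, Prod.fst_neg, Prod.snd_neg, symp_neg_left, symp_add_right, symp_self]
    ring

lemma hmul_hmul_neg (a p : Heis n) : hmul a (hmul (-a) p) = p := by
  simpa using hmul_neg_hmul (-a) p

lemma hmul_zero (a : Heis n) : hmul a 0 = a := by
  ext1 <;> simp [hmul]

lemma zero_hmul (a : Heis n) : hmul 0 a = a := by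
  ext1 <;> simp [hmul]

lemma neg_hmul_self (a : Heis n) : hmul (-a) a = 0 := by
  ext1 <;> simp [hmul, symp_neg_left]

lemma hmul_assoc (a b c : Heis n) : hmul (hmul a b) c = hmul a (hmul b c) := by
  ext1
  · simp [hmul, add_assoc]
  · simp only [hmul, symp_add_left, symp_add_right]
    ring

lemma exists_isHorizCurve (hn : 1 ≤ n) (p q : Heis n) :
    ∃ c cb, IsHorizCurve p q c cb ∧
      curveLength c ≤ 1000 * (‖(hmul (-p) q).1‖ + √|(hmul (-p) q).2|) := by
  obtain ⟨c, cb, h, hl⟩ := exists_isHorizCurve_zero hn (hmul (-p) q)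
  refine ⟨_, _, by simpa only [hmul_zero, hmul_hmul_neg] using h.hmul p, ?_⟩
  rwa [curveLength_const_add]

lemma ccDist_le (hn : 1 ≤ n) (p q : Heis n) :
    ccDist p q ≤ 1000 * (‖(hmul (-p) q).1‖ + √|(hmul (-p) q).2|) := by
  obtain ⟨c, cb, h, hl⟩ := exists_isHorizCurve hn p q
  exact h.ccDist_le.trans hl

lemma exists_isHorizCurve_lt (hn : 1 ≤ n) {p q : Heis n} {r : ℝ} (hr : ccDist p q < r) :
    ∃ c cb, IsHorizCurve p q c cb ∧ curveLength c < r := by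
  rw [ccDist_eq] at hr
  obtain ⟨c₀, cb₀, h₀, -⟩ := exists_isHorizCurve hn p q
  obtain ⟨_, ⟨c, cb, h, rfl⟩, hlt⟩ := exists_lt_of_csInf_lt (by exact ⟨_, c₀, cb₀, h₀, rfl⟩) hr
  exact ⟨c, cb, h, hlt⟩

lemma ccDist_triangle (hn : 1 ≤ n) (p q r : Heis n) :
    ccDist p r ≤ ccDist p q + ccDist q r := by
  refine le_of_forall_pos_le_add fun ε hε => ?_
  obtain ⟨c, cb, h, hl⟩ := exists_isHorizCurve_lt hn (lt_add_of_pos_right (ccDist p q) (half_pos hε))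
  obtain ⟨d, db, h', hl'⟩ :=
    exists_isHorizCurve_lt hn (lt_add_of_pos_right (ccDist q r) (half_pos hε))
  obtain ⟨K, hK⟩ := h.lipschitz_fst
  obtain ⟨K', hK'⟩ := h'.lipschitz_fst
  have := (h.concat h').ccDist_le
  rw [curveLength_concat hK hK' (h.fst_one.trans h'.fst_zero.symm)] at this
  linarith

lemma ccDist_hmul_le (hn : 1 ≤ n) (a p q : Heis n) :
    ccDist (hmul a p) (hmul a q) ≤ ccDist p q := by
  refine le_of_forall_gt_imp_ge_of_dense fun r hr => ?_
  obtain ⟨c, cb, h, hl⟩ := exists_isHorizCurve_lt hn hr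
  have := (h.hmul a).ccDist_le
  rw [curveLength_const_add] at this
  exact this.trans hl.le

/-- The Carnot–Carathéodory distance is left invariant. -/
lemma ccDist_hmul (hn : 1 ≤ n) (a p q : Heis n) :
    ccDist (hmul a p) (hmul a q) = ccDist p q := by
  refine (ccDist_hmul_le hn a p q).antisymm ?_
  simpa only [hmul_neg_hmul] using ccDist_hmul_le hn (-a) (hmul a p) (hmul a q)

/-- The Carnot–Carathéodory distance is homogeneous under dilations. -/
lemma ccDist_dil_le (hn : 1 ≤ n) {ε : ℝ} (hε : 0 < ε) (p q : Heis n) :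
    ccDist (dil ε p) (dil ε q) ≤ ε * ccDist p q := by
  rw [← div_le_iff₀' hε]
  refine le_of_forall_gt_imp_ge_of_dense fun r hr => ?_
  obtain ⟨c, cb, h, hl⟩ := exists_isHorizCurve_lt hn hr
  have := (h.dil ε).ccDist_le
  rw [curveLength_const_smul hε.le] at this
  rw [div_le_iff₀' hε]
  exact this.trans (by gcongr)

lemma ccDist_comm_le (hn : 1 ≤ n) (p q : Heis n) : ccDist p q ≤ ccDist q p := by
  refine le_of_forall_gt_imp_ge_of_dense fun r hr => ?_
  obtain ⟨c, cb, h, hl⟩ := exists_isHorizCurve_lt hn hr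
  have := h.reverse.ccDist_le
  rw [curveLength_reverse] at this
  exact this.trans hl.le

lemma ccDist_self (hn : 1 ≤ n) (p : Heis n) : ccDist p p = 0 := by
  refine le_antisymm ((ccDist_le hn p p).trans ?_) (ccDist_nonneg p p)
  simp [neg_hmul_self]

lemma norm_fst_le_ccDist_zero (hn : 1 ≤ n) (p : Heis n) : ‖p.1‖ ≤ ccDist 0 p := by
  refine le_of_forall_gt_imp_ge_of_dense fun r hr => ?_
  obtain ⟨c, cb, h, hl⟩ := exists_isHorizCurve_lt hn hr
  obtain ⟨K, hK⟩ := h.lipschitz_fst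
  rw [← h.fst_one]
  exact (norm_le_curveLength hK h.fst_zero (by simp)).trans hl.le

lemma abs_snd_le_ccDist_zero (hn : 1 ≤ n) (p : Heis n) : |p.2| ≤ ccDist 0 p ^ 2 := by
  rw [← Real.sqrt_le_left (ccDist_nonneg 0 p)]
  refine le_of_forall_gt_imp_ge_of_dense fun r hr => ?_
  obtain ⟨c, cb, h, hl⟩ := exists_isHorizCurve_lt hn hr
  exact (Real.sqrt_le_left (curveLength_nonneg c)).2 h.abs_snd_le |>.trans hl.le

lemma ccDist_eq_zero_left (hn : 1 ≤ n) (p q : Heis n) : ccDist p q = ccDist 0 (hmul (-p) q) := by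
  rw [← ccDist_hmul hn (-p), neg_hmul_self]

lemma eq_of_ccDist_eq_zero (hn : 1 ≤ n) {p q : Heis n} (h : ccDist p q = 0) : p = q := by
  rw [ccDist_eq_zero_left hn] at h
  have h1 := norm_fst_le_ccDist_zero hn (hmul (-p) q)
  have h2 := abs_snd_le_ccDist_zero hn (hmul (-p) q)
  rw [h] at h1 h2
  have h0 : hmul (-p) q = 0 := by
    ext1
    · exact norm_le_zero_iff.1 h1
    · exact abs_nonpos_iff.1 (by simpa using h2)
  rw [← hmul_hmul_neg p q, h0, hmul_zero]

lemma continuous_hmul : Continuous fun x : Heis n × Heis n => hmul x.1 x.2 := by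
  have := continuous_symp (n := n).comp
    ((continuous_fst.comp continuous_fst).prodMk (continuous_fst.comp continuous_snd) :
      Continuous fun x : Heis n × Heis n => (x.1.1, x.2.1))
  simp only [comp_def] at this
  unfold hmul
  fun_prop

/-- The Carnot–Carathéodory distance induces the Euclidean topology. -/
lemma nhds_eq_comap_ccDist (hn : 1 ≤ n) (p : Heis n) :
    𝓝 p = Filter.comap (fun q => ccDist p q) (𝓝 0) := by
  refine le_antisymm ?_ ?_
  · rw [← Filter.tendsto_iff_comap]
    have hc : Continuous fun q : Heis n => hmul (-p) q :=
      continuous_hmul.comp (Continuous.prodMk_right (-p))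
    have : Continuous fun q => 1000 * (‖(hmul (-p) q).1‖ + √|(hmul (-p) q).2|) :=
      continuous_const.mul (hc.fst.norm.add hc.snd.abs.sqrt)
    have ht := this.tendsto p
    simp only [neg_hmul_self, Prod.fst_zero, norm_zero, Prod.snd_zero, abs_zero, Real.sqrt_zero,
      add_zero, mul_zero] at ht
    exact squeeze_zero (fun q => ccDist_nonneg p q) (fun q => ccDist_le hn p q) ht
  · set l := Filter.comap (fun q => ccDist p q) (𝓝 (0 : ℝ))
    have ht : Filter.Tendsto (fun q => ccDist p q) l (𝓝 0) := Filter.tendsto_comap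
    have h0 : Filter.Tendsto (fun q => hmul (-p) q) l (𝓝 ((0 : E n), (0 : ℝ))) := by
      have h1 : ∀ q, ‖(hmul (-p) q).1‖ ≤ ccDist p q := fun q =>
        (norm_fst_le_ccDist_zero hn _).trans_eq (ccDist_eq_zero_left hn p q).symm
      have h2 : ∀ q, ‖(hmul (-p) q).2‖ ≤ ccDist p q ^ 2 := fun q => by
        rw [ccDist_eq_zero_left hn p q]
        exact abs_snd_le_ccDist_zero hn _
      have ht2 : Filter.Tendsto (fun q => ccDist p q ^ 2) l (𝓝 0) := by simpa using ht.pow 2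
      exact (squeeze_zero_norm h1 ht).prodMk_nhds (squeeze_zero_norm h2 ht2)
    have hc : Continuous fun q : Heis n => hmul p q :=
      continuous_hmul.comp (Continuous.prodMk_right p)
    have h1 := (hc.tendsto ((0 : E n), (0 : ℝ))).comp h0
    have h2 : hmul p ((0 : E n), (0 : ℝ)) = p := hmul_zero p
    simp only [comp_def, hmul_hmul_neg, h2] at h1
    exact h1

end Metric

section Group

lemma dil_inv_image_dil_image {n : ℕ} {ε : ℝ} (hε : ε ≠ 0) (S : Set (Heis n)) :
    dil ε⁻¹ '' (dil ε '' S) = S := by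
  have : (fun p : Heis n => dil ε⁻¹ (dil ε p)) = id := by
    funext p
    ext1
    · simp [dil, smul_smul, hε]
    · simp [dil, hε]
  rw [image_image, this, image_id]

lemma ccDist_zero_le {n : ℕ} (hn : 1 ≤ n) (p : Heis n) :
    ccDist 0 p ≤ 1000 * (‖p.1‖ + √|p.2|) := by
  simpa [zero_hmul] using ccDist_le hn 0 p

/-- The Heisenberg group, carrying its group structure and the Carnot–Carathéodory metric. -/
def HeisGroup (n : ℕ) := Heis n

namespace HeisGroup

variable {n : ℕ}

instance : TopologicalSpace (HeisGroup n) := inferInstanceAs (TopologicalSpace (E n × ℝ))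
instance : SecondCountableTopology (HeisGroup n) :=
  inferInstanceAs (SecondCountableTopology (E n × ℝ))
instance : LocallyCompactSpace (HeisGroup n) := inferInstanceAs (LocallyCompactSpace (E n × ℝ))
instance : MeasureSpace (HeisGroup n) := inferInstanceAs (MeasureSpace (E n × ℝ))
instance : BorelSpace (HeisGroup n) := inferInstanceAs (BorelSpace (E n × ℝ))
instance : IsFiniteMeasureOnCompacts (volume : Measure (HeisGroup n)) :=
  inferInstanceAs (IsFiniteMeasureOnCompacts (volume : Measure (E n × ℝ)))
instance : Measure.IsOpenPosMeasure (volume : Measure (HeisGroup n)) :=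
  inferInstanceAs (Measure.IsOpenPosMeasure (volume : Measure (E n × ℝ)))
instance : SigmaFinite (volume : Measure (HeisGroup n)) :=
  inferInstanceAs (SigmaFinite (volume : Measure (E n × ℝ)))

instance : Group (HeisGroup n) where
  mul := hmul (n := n)
  one := (0 : Heis n)
  inv p := -(show Heis n from p)
  mul_assoc := hmul_assoc (n := n)
  one_mul := zero_hmul (n := n)
  mul_one := hmul_zero (n := n)
  inv_mul_cancel := neg_hmul_self (n := n)

instance : IsTopologicalGroup (HeisGroup n) where
  continuous_mul := continuous_hmul (n := n)
  continuous_inv := continuous_neg (G := E n × ℝ)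

instance [NeZero n] : MetricSpace (HeisGroup n) :=
  let m : MetricSpace (HeisGroup n) :=
    { dist := ccDist (n := n)
      dist_self := ccDist_self (n := n) NeZero.one_le
      dist_comm := fun p q => (ccDist_comm_le NeZero.one_le p q).antisymm
        (ccDist_comm_le NeZero.one_le q p)
      dist_triangle := ccDist_triangle (n := n) NeZero.one_le
      eq_of_dist_eq_zero := eq_of_ccDist_eq_zero (n := n) NeZero.one_le }
  m.replaceTopology <| TopologicalSpace.ext_nhds fun p => by
    rw [← nhds_comap_dist p]
    refine (nhds_eq_comap_ccDist (n := n) NeZero.one_le p).trans ?_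
    congr 1
    ext q
    exact m.dist_comm p q

lemma dist_eq [NeZero n] (p q : HeisGroup n) : dist p q = ccDist (n := n) p q := rfl

instance [NeZero n] : IsIsometricSMul (HeisGroup n) (HeisGroup n) :=
  ⟨fun a => Isometry.of_dist_eq fun p q => ccDist_hmul (n := n) NeZero.one_le a p q⟩

lemma ediam_eq_ccDiam [NeZero n] (S : Set (HeisGroup n)) : Metric.ediam S = ccDiam (n := n) S := by
  simp only [Metric.ediam, ccDiam, edist_dist, dist_eq]
  rfl

/-- Lebesgue measure is left invariant on the Heisenberg group. -/
instance : Measure.IsMulLeftInvariant (volume : Measure (HeisGroup n)) where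
  map_mul_left_eq_self a := by
    have h : MeasurePreserving (fun q : E n × ℝ => (a.1 + q.1, a.2 + q.2 + (1/2) * symp a.1 q.1))
        ((volume : Measure (E n)).prod (volume : Measure ℝ))
        ((volume : Measure (E n)).prod (volume : Measure ℝ)) := by
      refine (measurePreserving_add_left (volume : Measure (E n)) a.1).skew_product
        (g := fun x t => a.2 + t + (1/2) * symp a.1 x) ?_ (Filter.Eventually.of_forall fun x => ?_)
      · have : Continuous fun x : E n => symp a.1 x := (sympCLM a.1).continuous
        exact (by fun_prop : Continuous fun p : E n × ℝ =>
          a.2 + p.2 + (1/2) * symp a.1 p.1).measurable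
      · have := ((measurePreserving_add_right (volume : Measure ℝ) ((1/2) * symp a.1 x)).comp
          (measurePreserving_add_left (volume : Measure ℝ) a.2)).map_eq
        exact this
    exact h.map_eq

instance : Measure.IsHaarMeasure (volume : Measure (HeisGroup n)) where

/-- The product of a Euclidean ball of radius `r` and an interval of radius `r ^ 2`. -/
def box (n : ℕ) (r : ℝ) : Set (HeisGroup n) :=
  (Metric.closedBall (0 : E n) r ×ˢ Metric.closedBall (0 : ℝ) (r ^ 2) : Set (E n × ℝ))

lemma volume_box {r : ℝ} (hr : 0 ≤ r) :
    volume (box n r) = ENNReal.ofReal r ^ (2 * n + 2) * volume (box n 1) := by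
  have h : ∀ s, volume (box n s) =
      volume (Metric.closedBall (0 : E n) s) * volume (Metric.closedBall (0 : ℝ) (s ^ 2)) :=
    fun s => Measure.prod_prod (μ := (volume : Measure (E n))) (ν := (volume : Measure ℝ)) _ _
  rw [h, h, Measure.addHaar_closedBall' _ _ hr,
    Measure.addHaar_closedBall' (volume : Measure ℝ) _ (sq_nonneg r)]
  have hd : Module.finrank ℝ (E n) = 2 * n := by simp [two_mul]
  rw [hd, Module.finrank_self, pow_one, one_pow, ENNReal.ofReal_pow hr, ENNReal.ofReal_pow hr,
    pow_add]
  ring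

lemma isCompact_box (r : ℝ) : IsCompact (box n r) :=
  (isCompact_closedBall (0 : E n) r).prod (isCompact_closedBall (0 : ℝ) (r ^ 2))

lemma volume_box_ne_top (r : ℝ) : volume (box n r) ≠ ⊤ := (isCompact_box r).measure_ne_top

lemma volume_box_one_ne_zero : volume (box n 1) ≠ 0 := by
  have h : box n 1 ∈ 𝓝 (1 : HeisGroup n) :=
    prod_mem_nhds (Metric.closedBall_mem_nhds (0 : E n) one_pos)
      (Metric.closedBall_mem_nhds (0 : ℝ) (by norm_num))
  exact (Measure.measure_pos_of_mem_nhds volume h).ne'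

/-- The dilations, as maps of the metric space `HeisGroup n`. -/
def dilation (ε : ℝ) : HeisGroup n → HeisGroup n := dil (n := n) ε

lemma dilation_inv_image_dilation_image {ε : ℝ} (hε : ε ≠ 0) (S : Set (HeisGroup n)) :
    dilation ε⁻¹ '' (dilation ε '' S) = S :=
  dil_inv_image_dil_image (n := n) hε S

variable [NeZero n]

lemma closedBall_one_subset_box {r : ℝ} : Metric.closedBall (1 : HeisGroup n) r ⊆ box n r := by
  intro p hp
  have hp' : ccDist (n := n) 0 p ≤ r := by rwa [Metric.mem_closedBall, dist_comm] at hp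
  have h1 := norm_fst_le_ccDist_zero (n := n) NeZero.one_le p
  have h2 := abs_snd_le_ccDist_zero (n := n) NeZero.one_le p
  refine ⟨mem_closedBall_zero_iff.2 (h1.trans hp'), mem_closedBall_zero_iff.2 (h2.trans ?_)⟩
  exact pow_le_pow_left₀ (ccDist_nonneg (n := n) 0 p) hp' 2

lemma box_subset_closedBall_one {r : ℝ} (hr : 0 ≤ r) :
    box n (r / 2000) ⊆ Metric.closedBall (1 : HeisGroup n) r := by
  rintro p ⟨h1, h2⟩
  rw [mem_closedBall_zero_iff] at h1 h2
  rw [Metric.mem_closedBall, dist_comm]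
  refine (ccDist_zero_le (n := n) NeZero.one_le p).trans ?_
  have h3 : √|p.2| ≤ r / 2000 := (Real.sqrt_le_left (by positivity)).2 h2
  linarith

lemma volume_closedBall_eq (x : HeisGroup n) (r : ℝ) :
    volume (Metric.closedBall x r) = volume (Metric.closedBall (1 : HeisGroup n) r) := by
  rw [← measure_preimage_mul volume x⁻¹ (Metric.closedBall (1 : HeisGroup n) r)]
  congr 1
  ext y
  rw [mem_preimage, Metric.mem_closedBall, Metric.mem_closedBall, ← dist_smul x⁻¹ y x,
    smul_eq_mul, smul_eq_mul, inv_mul_cancel]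

lemma volume_closedBall_le (x : HeisGroup n) {r : ℝ} (hr : 0 ≤ r) :
    volume (Metric.closedBall x r) ≤ ENNReal.ofReal r ^ (2 * n + 2) * volume (box n 1) := by
  rw [volume_closedBall_eq, ← volume_box hr]
  exact measure_mono closedBall_one_subset_box

lemma le_volume_closedBall (x : HeisGroup n) {r : ℝ} (hr : 0 ≤ r) :
    ENNReal.ofReal (r / 2000) ^ (2 * n + 2) * volume (box n 1) ≤
      volume (Metric.closedBall x r) := by
  rw [volume_closedBall_eq, ← volume_box (by positivity)]
  exact measure_mono (box_subset_closedBall_one hr)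

/-- The Hausdorff measure of dimension `2n+2` dominates a positive multiple of Lebesgue measure. -/
lemma smul_volume_le_hausdorffMeasure :
    (volume (box n 1))⁻¹ • (volume : Measure (HeisGroup n)) ≤ μH[((2 * n + 2 : ℕ) : ℝ)] := by
  refine Measure.le_hausdorffMeasure _ _ 1 one_pos fun s hs => ?_
  rcases s.eq_empty_or_nonempty with rfl | ⟨x, hx⟩
  · simp
  have htop : Metric.ediam s ≠ ⊤ := ne_top_of_le_ne_top ENNReal.one_ne_top hs
  have hsub : s ⊆ Metric.closedBall x (Metric.ediam s).toReal := fun y hy => by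
    rw [Metric.mem_closedBall, dist_edist]
    exact ENNReal.toReal_mono htop (Metric.edist_le_ediam_of_mem hy hx)
  have h := (measure_mono hsub).trans (volume_closedBall_le x ENNReal.toReal_nonneg)
  rw [ENNReal.ofReal_toReal htop] at h
  rw [Measure.smul_apply, smul_eq_mul, ENNReal.rpow_natCast]
  calc (volume (box n 1))⁻¹ * volume s
      ≤ (volume (box n 1))⁻¹ * (Metric.ediam s ^ (2 * n + 2) * volume (box n 1)) := by gcongr
    _ = Metric.ediam s ^ (2 * n + 2) * ((volume (box n 1))⁻¹ * volume (box n 1)) := by ring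
    _ = Metric.ediam s ^ (2 * n + 2) := by
      rw [ENNReal.inv_mul_cancel volume_box_one_ne_zero (volume_box_ne_top 1), mul_one]

lemma isCompact_closedBall_one (r : ℝ) : IsCompact (Metric.closedBall (1 : HeisGroup n) r) :=
  (isCompact_box r).of_isClosed_subset Metric.isClosed_closedBall closedBall_one_subset_box

/-- Volume bound for the cardinality of a separated subset of the unit ball. -/
lemma card_mul_le_of_isSeparated {ε : ℝ≥0} (hε : ε ≤ 1) {N : Finset (HeisGroup n)}
    (hN : (N : Set (HeisGroup n)) ⊆ Metric.closedBall 1 1)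
    (hsep : Metric.IsSeparated (ε : ℝ≥0∞) (N : Set (HeisGroup n))) :
    (N.card : ℝ≥0∞) * (ε : ℝ≥0∞) ^ (2 * n + 2) ≤ 8000 ^ (2 * n + 2) := by
  have hε' : (ε : ℝ) ≤ 1 := by exact_mod_cast hε
  have hdisj : (N : Set (HeisGroup n)).PairwiseDisjoint
      fun x => Metric.closedBall x ((ε : ℝ) / 2) := fun x hx y hy hxy => by
    refine Metric.closedBall_disjoint_closedBall ?_
    have : (ε : ℝ≥0∞) < edist x y := hsep hx hy hxy
    rw [edist_nndist, ENNReal.coe_lt_coe, ← NNReal.coe_lt_coe, coe_nndist] at this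
    linarith
  have hsub : ⋃ x ∈ N, Metric.closedBall x ((ε : ℝ) / 2) ⊆ Metric.closedBall 1 2 :=
    iUnion₂_subset fun x hx => Metric.closedBall_subset_closedBall' (by
      have := Metric.mem_closedBall.1 (hN hx)
      linarith)
  have h := measure_mono (μ := volume) hsub
  rw [measure_biUnion_finset hdisj fun x _ => Metric.isClosed_closedBall.measurableSet] at h
  have h1 : N.card • (ENNReal.ofReal ((ε : ℝ) / 2 / 2000) ^ (2 * n + 2) * volume (box n 1)) ≤
      ENNReal.ofReal 2 ^ (2 * n + 2) * volume (box n 1) :=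
    (Finset.card_nsmul_le_sum _ _ _ fun x _ => le_volume_closedBall x (by positivity)).trans
      (h.trans (volume_closedBall_le 1 zero_le_two))
  rw [nsmul_eq_mul, ← mul_assoc, ENNReal.mul_le_mul_iff_left volume_box_one_ne_zero
    (volume_box_ne_top 1)] at h1
  have he : (ε : ℝ≥0∞) = 4000 * ENNReal.ofReal ((ε : ℝ) / 2 / 2000) := by
    rw [← ENNReal.ofReal_ofNat, ← ENNReal.ofReal_mul (by norm_num), ← ENNReal.ofReal_coe_nnreal]
    congr 1
    ring
  calc (N.card : ℝ≥0∞) * (ε : ℝ≥0∞) ^ (2 * n + 2)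
      = 4000 ^ (2 * n + 2) * (N.card * ENNReal.ofReal ((ε : ℝ) / 2 / 2000) ^ (2 * n + 2)) := by
        rw [he, mul_pow]; ring
    _ ≤ 4000 ^ (2 * n + 2) * ENNReal.ofReal 2 ^ (2 * n + 2) := by gcongr
    _ = 8000 ^ (2 * n + 2) := by
        rw [← mul_pow, ENNReal.ofReal_ofNat]
        norm_num

/-- A finite cover of the unit ball by small balls, with controlled cardinality. -/
lemma exists_finset_cover {ε : ℝ≥0} (h0 : ε ≠ 0) (hε : ε ≤ 1) :
    ∃ N : Finset (HeisGroup n),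
      Metric.closedBall (1 : HeisGroup n) 1 ⊆ ⋃ x ∈ N, Metric.closedBall x ε ∧
      (N.card : ℝ≥0∞) * (ε : ℝ≥0∞) ^ (2 * n + 2) ≤ 8000 ^ (2 * n + 2) := by
  set K := Metric.closedBall (1 : HeisGroup n) 1
  have hpack : Metric.packingNumber ε K ≠ ⊤ := by
    obtain ⟨C, -, hfin, hC⟩ := Metric.exists_finite_isCover_of_isCompact
      (ε := ε / 2) (by simpa using h0) (isCompact_closedBall_one (n := n) 1)
    have h1 := Metric.packingNumber_two_mul_le_externalCoveringNumber (ε / 2) K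
    rw [mul_div_cancel₀ _ two_ne_zero] at h1
    exact ne_top_of_le_ne_top (encard_ne_top_iff.2 hfin)
      (h1.trans hC.externalCoveringNumber_le_encard)
  have hfin : (Metric.maximalSeparatedSet ε K).Finite := by
    rw [← encard_ne_top_iff, Metric.encard_maximalSeparatedSet hpack]
    exact hpack
  have hcover := Metric.isCover_maximalSeparatedSet hpack
  rw [Metric.isCover_iff_subset_iUnion_closedBall] at hcover
  refine ⟨hfin.toFinset, by simpa using hcover, card_mul_le_of_isSeparated hε ?_ ?_⟩
  · simpa using Metric.maximalSeparatedSet_subset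
  · simpa using Metric.isSeparated_maximalSeparatedSet

lemma hausdorffMeasure_closedBall_one_ne_top :
    μH[((2 * n + 2 : ℕ) : ℝ)] (Metric.closedBall (1 : HeisGroup n) 1) ≠ ⊤ := by
  let ε : ℕ → ℝ≥0 := fun k => 1 / ((k : ℝ≥0) + 1)
  have h0 : ∀ k, ε k ≠ 0 := fun k => by positivity
  have h1 : ∀ k, ε k ≤ 1 := fun k => by
    refine div_le_one_of_le₀ ?_ (by positivity)
    simp
  choose N hcov hcard using fun k => exists_finset_cover (n := n) (h0 k) (h1 k)
  have hdiam : ∀ k (x : HeisGroup n),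
      Metric.ediam (Metric.closedBall x (ε k : ℝ)) ≤ 2 * (ε k : ℝ≥0∞) := fun k x => by
    rw [← Metric.closedEBall_coe]
    exact Metric.ediam_closedEBall_le
  have hlim : Filter.Tendsto (fun k => 2 * (ε k : ℝ≥0∞)) Filter.atTop (𝓝 0) := by
    have : Filter.Tendsto ε Filter.atTop (𝓝 0) := tendsto_one_div_add_atTop_nhds_zero_nat
    have h2 := ENNReal.Tendsto.const_mul (a := 2) (ENNReal.tendsto_coe.2 this)
      (Or.inr (by simp))
    simpa using h2
  have hle := Measure.hausdorffMeasure_le_liminf_sum ((2 * n + 2 : ℕ) : ℝ)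
    (Metric.closedBall (1 : HeisGroup n) 1) (fun k => 2 * (ε k : ℝ≥0∞)) hlim
    (fun k (x : N k) => Metric.closedBall (x : HeisGroup n) (ε k))
    (Filter.Eventually.of_forall fun k x => hdiam k x)
    (Filter.Eventually.of_forall fun k => by simpa [iUnion_subtype] using hcov k)
  refine ne_top_of_le_ne_top (b := (2 : ℝ≥0∞) ^ (2 * n + 2) * 8000 ^ (2 * n + 2))
    (by finiteness) (hle.trans ?_)
  refine Filter.liminf_le_of_le (by isBoundedDefault) fun b hb => ?_
  obtain ⟨k, hk⟩ := hb.exists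
  refine hk.trans ?_
  calc ∑ x : N k, Metric.ediam (Metric.closedBall (x : HeisGroup n) (ε k)) ^ ((2 * n + 2 : ℕ) : ℝ)
      ≤ ∑ x : N k, (2 * (ε k : ℝ≥0∞)) ^ (2 * n + 2) := by
        refine Finset.sum_le_sum fun x _ => ?_
        rw [ENNReal.rpow_natCast]
        gcongr
        exact hdiam k x
    _ = 2 ^ (2 * n + 2) * ((N k).card * (ε k : ℝ≥0∞) ^ (2 * n + 2)) := by
        simp [mul_pow]; ring
    _ ≤ 2 ^ (2 * n + 2) * 8000 ^ (2 * n + 2) := by gcongr; exact hcard k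

/-- The Hausdorff measure of dimension `2n+2` is a positive multiple of Lebesgue measure. -/
lemma exists_hausdorffMeasure_eq_smul_volume :
    ∃ κ : ℝ≥0, κ ≠ 0 ∧
      (μH[((2 * n + 2 : ℕ) : ℝ)] : Measure (HeisGroup n)) = κ • volume := by
  set μ : Measure (HeisGroup n) := μH[((2 * n + 2 : ℕ) : ℝ)]
  have hK : (Metric.closedBall (1 : HeisGroup n) 1) ∈ 𝓝 1 := Metric.closedBall_mem_nhds _ one_pos
  have hpos : μ (Metric.closedBall (1 : HeisGroup n) 1) ≠ 0 := by
    intro h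
    have h1 := (smul_volume_le_hausdorffMeasure (n := n) _).trans_eq h
    rw [nonpos_iff_eq_zero, Measure.smul_apply, smul_eq_mul, mul_eq_zero] at h1
    rcases h1 with h1 | h1
    · exact volume_box_ne_top 1 (ENNReal.inv_eq_zero.1 h1)
    · exact (Measure.measure_pos_of_mem_nhds volume hK).ne' h1
  have hHaar : μ.IsHaarMeasure := Measure.isHaarMeasure_of_isCompact_nonempty_interior μ _
    (isCompact_closedBall_one 1) ⟨1, mem_interior_iff_mem_nhds.2 hK⟩ hpos
    hausdorffMeasure_closedBall_one_ne_top
  have heq := Measure.isMulLeftInvariant_eq_smul μ (volume : Measure (HeisGroup n))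
  refine ⟨_, fun h => hpos ?_, heq⟩
  rw [heq, h, zero_smul, Measure.coe_zero, Pi.zero_apply]

/-- In positive dimension, `hausMeas` is the Hausdorff measure of the metric space. -/
lemma hausMeas_eq_hausdorffMeasure {d : ℝ} (hd : 0 < d) (S : Set (HeisGroup n)) :
    hausMeas (n := n) d S = μH[d] S := by
  have hterm : ∀ U : Set (HeisGroup n),
      (⨆ _ : U.Nonempty, ccDiam (n := n) U ^ d) = ccDiam (n := n) U ^ d := fun U => by
    rcases U.eq_empty_or_nonempty with rfl | hU
    · rw [← ediam_eq_ccDiam]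
      simp [hd]
    · simp [hU]
  rw [Measure.hausdorffMeasure_apply]
  simp only [ediam_eq_ccDiam, hterm]
  unfold hausMeas
  refine le_antisymm (iSup₂_le fun δ hδ => ?_) (iSup₂_le fun r hr => ?_)
  · refine le_iSup₂_of_le (ENNReal.ofReal δ) (ENNReal.ofReal_pos.2 hδ) ?_
    exact le_iInf fun U => le_iInf₂ fun h1 h2 => iInf₂_le U ⟨h2, h1⟩
  · obtain ⟨δ, hδ, hδr⟩ : ∃ δ : ℝ, 0 < δ ∧ ENNReal.ofReal δ ≤ r := by
      rcases eq_or_ne r ⊤ with rfl | hr'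
      · exact ⟨1, one_pos, le_top⟩
      · exact ⟨r.toReal, ENNReal.toReal_pos hr.ne' hr', ENNReal.ofReal_toReal_le⟩
    refine le_iSup₂_of_le δ hδ ?_
    refine le_iInf₂ fun U hU => ?_
    exact iInf_le_of_le U (iInf₂_le hU.2 fun i => (hU.1 i).trans hδr)

lemma dist_dilation_le {ε : ℝ} (hε : 0 < ε) (p q : HeisGroup n) :
    dist (dilation ε p) (dilation ε q) ≤ ε * dist p q :=
  ccDist_dil_le (n := n) NeZero.one_le hε p q

lemma hausdorffMeasure_dilation_image_le {ε : ℝ} (hε : 0 < ε) {d : ℝ} (hd : 0 ≤ d)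
    (S : Set (HeisGroup n)) : μH[d] (dilation ε '' S) ≤ ENNReal.ofReal ε ^ d * μH[d] S := by
  have h : LipschitzWith ε.toNNReal (dilation (n := n) ε) :=
    LipschitzWith.of_dist_le_mul fun p q => by
      rw [Real.coe_toNNReal _ hε.le]
      exact dist_dilation_le hε p q
  exact h.lipschitzOnWith.hausdorffMeasure_image_le hd

/-- The Hausdorff measures are homogeneous under dilations. -/
lemma hausdorffMeasure_dilation_image {ε : ℝ} (hε : 0 < ε) {d : ℝ} (hd : 0 ≤ d)
    (S : Set (HeisGroup n)) : μH[d] (dilation ε '' S) = ENNReal.ofReal ε ^ d * μH[d] S := by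
  refine (hausdorffMeasure_dilation_image_le hε hd S).antisymm ?_
  have h := hausdorffMeasure_dilation_image_le (inv_pos.2 hε) hd (dilation ε '' S)
  rw [dilation_inv_image_dilation_image hε.ne'] at h
  have h0 : ENNReal.ofReal ε ≠ 0 := (ENNReal.ofReal_pos.2 hε).ne'
  calc ENNReal.ofReal ε ^ d * μH[d] S
      ≤ ENNReal.ofReal ε ^ d * (ENNReal.ofReal ε⁻¹ ^ d * μH[d] (dilation ε '' S)) := by gcongr
    _ = μH[d] (dilation ε '' S) := by
      rw [← mul_assoc, ← ENNReal.mul_rpow_of_nonneg _ _ hd, ENNReal.ofReal_inv_of_pos hε,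
        ENNReal.mul_inv_cancel h0 ENNReal.ofReal_ne_top, ENNReal.one_rpow, one_mul]

lemma hausdorffMeasure_univ_eq_top {d : ℝ} (hd : d < ((2 * n + 2 : ℕ) : ℝ)) :
    μH[d] (univ : Set (HeisGroup n)) = ⊤ := by
  obtain ⟨κ, hκ, hμ⟩ := exists_hausdorffMeasure_eq_smul_volume (n := n)
  refine (Measure.hausdorffMeasure_zero_or_top hd _).resolve_left fun h => ?_
  rw [hμ, Measure.smul_apply, ENNReal.smul_def, smul_eq_mul, mul_eq_zero, ENNReal.coe_eq_zero] at h
  exact h.elim hκ (isOpen_univ.measure_pos volume ⟨1, mem_univ _⟩).ne'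

lemma hausdorffMeasure_univ_eq_zero {d : ℝ} (hd : ((2 * n + 2 : ℕ) : ℝ) < d) :
    μH[d] (univ : Set (HeisGroup n)) = 0 := by
  obtain ⟨κ, -, hμ⟩ := exists_hausdorffMeasure_eq_smul_volume (n := n)
  rw [← iUnion_spanningSets (volume : Measure (HeisGroup n))]
  refine measure_iUnion_null fun i => ?_
  refine (Measure.hausdorffMeasure_zero_or_top hd _).resolve_right ?_
  rw [hμ, Measure.smul_apply]
  exact (ENNReal.mul_lt_top ENNReal.coe_lt_top (measure_spanningSets_lt_top volume i)).ne

end HeisGroup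

end Group

/-- The `Q = 2n+2` dimensional Hausdorff measure of `(H(n), d_CC)` is left
invariant, scales as `ε^Q` under dilations, and is a nonzero finite multiple of the
Lebesgue measure on `ℝ^{2n+1}`; in particular the Hausdorff dimension of
`(H(n), d_CC)` is `Q = 2n+2`. -/
theorem hausdorff_measure_of_Heisenberg (n : ℕ) (hn : 1 ≤ n) :
    (∀ (p : Heis n) (S : Set (Heis n)), MeasurableSet S →
      hausMeas ((2*n+2 : ℕ) : ℝ) ((fun q : Heis n => hmul p q) '' S)
        = hausMeas ((2*n+2 : ℕ) : ℝ) S) ∧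
    (∀ (ε : ℝ), 0 < ε → ∀ S : Set (Heis n), MeasurableSet S →
      hausMeas ((2*n+2 : ℕ) : ℝ) (dil ε '' S)
        = ENNReal.ofReal (ε ^ (2*n+2 : ℕ)) * hausMeas ((2*n+2 : ℕ) : ℝ) S) ∧
    (∃ κ : ℝ≥0∞, 0 < κ ∧ κ < ⊤ ∧
      ∀ S : Set (Heis n), MeasurableSet S →
        hausMeas ((2*n+2 : ℕ) : ℝ) S = κ * volume S) ∧
    (∀ d : ℝ, 0 ≤ d → d < ((2*n+2 : ℕ) : ℝ) →
      hausMeas d (Set.univ : Set (Heis n)) = ⊤) ∧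
    (∀ d : ℝ, ((2*n+2 : ℕ) : ℝ) < d →
      hausMeas d (Set.univ : Set (Heis n)) = 0) := by
  have : NeZero n := ⟨Nat.one_le_iff_ne_zero.1 hn⟩
  have hQ : (0 : ℝ) < ((2 * n + 2 : ℕ) : ℝ) := by positivity
  obtain ⟨κ, hκ, hμ⟩ := HeisGroup.exists_hausdorffMeasure_eq_smul_volume (n := n)
  refine ⟨fun p S _ => ?_, fun ε hε S _ => ?_, ⟨κ, by positivity, ENNReal.coe_lt_top, fun S _ => ?_⟩,
    fun d hd0 hd => ?_, fun d hd => ?_⟩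
  · refine (HeisGroup.hausMeas_eq_hausdorffMeasure hQ _).trans
      (Eq.trans ?_ (HeisGroup.hausMeas_eq_hausdorffMeasure hQ S).symm)
    exact (IsometryEquiv.constSMul (X := HeisGroup n) (show HeisGroup n from p)).hausdorffMeasure_image
      _ S
  · refine (HeisGroup.hausMeas_eq_hausdorffMeasure hQ _).trans ?_
    refine (HeisGroup.hausdorffMeasure_dilation_image hε hQ.le S).trans ?_
    rw [ENNReal.rpow_natCast, ENNReal.ofReal_pow hε.le]
    congr 1
    exact (HeisGroup.hausMeas_eq_hausdorffMeasure hQ S).symm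
  · refine (HeisGroup.hausMeas_eq_hausdorffMeasure hQ S).trans ?_
    rw [hμ]
    rfl
  · rcases hd0.eq_or_lt with rfl | hd0
    · refine eq_top_iff.2 (le_iSup₂_of_le 1 one_pos (le_iInf₂ fun U _ => ?_))
      simp
    · exact (HeisGroup.hausMeas_eq_hausdorffMeasure hd0 _).trans
        (HeisGroup.hausdorffMeasure_univ_eq_top hd)
  · exact (HeisGroup.hausMeas_eq_hausdorffMeasure (hQ.trans hd) _).trans
      (HeisGroup.hausdorffMeasure_univ_eq_zero hd)
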